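/- arXiv:2011.09511 — 2 statements merged into one kernel-verified Lean document; each statement's English description precedes it below -/
import Mathlib

section
/- Let x : U → ℝ³ be a wavefront, Ω a tmb of x, and p ∈ Σ(x) with rank(Dx(p)) = 1, K_Ω(p) ≠ 0 and H_Ω(p) < 0. Then the following are equivalent: (1) x is parallelly smoothable at p; (2) H(u,v) tends to +∞ or tends to −∞ as (u,v) → p through Σ(x)ᶜ; (3) k₁(u,v) tends to +∞ or tends to −∞ as (u,v) → p through Σ(x)ᶜ; (4) K(u,v) tends to +∞ or tends to −∞ as (u,v) → p through Σ(x)ᶜ; (5) λ_Ω does not change sign on some open neighborhood of p; (6) k_{2Ω} does not change sign on some open neighborhood of p. (The analogous statement with k₂ in (3) and k_{1Ω} in (6) holds when H_Ω(p) > 0.) -/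
/- Common framework for frontals and tangent moving bases, following
   "Curvatures on fronts" conventions. -/

noncomputable section

open Matrix Topology Filter

/-- Points of the plane ℝ². -/
abbrev Pt : Type := Fin 2 → ℝ

/-- Jacobian matrix of a map `f : ℝ² → ℝ^m` at a point. -/
def jac {m : ℕ} (f : Pt → (Fin m → ℝ)) (p : Pt) : Matrix (Fin m) (Fin 2) ℝ :=
  Matrix.of fun i j => fderiv ℝ f p (Pi.single j 1) i

/-- Euclidean norm of a vector in ℝ³. -/
def enorm3 (v : Fin 3 → ℝ) : ℝ := Real.sqrt (v ⬝ᵥ v)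

/-- The unit normal vector field induced by a tangent moving base `Ω`,
    `n := (w₁ × w₂)/‖w₁ × w₂‖` where `w₁, w₂` are the columns of `Ω`. -/
def normalOf (Ω : Pt → Matrix (Fin 3) (Fin 2) ℝ) (p : Pt) : Fin 3 → ℝ :=
  (enorm3 (crossProduct (fun i => Ω p i 0) (fun i => Ω p i 1)))⁻¹ •
    crossProduct (fun i => Ω p i 0) (fun i => Ω p i 1)

/-- First fundamental form matrix of a map `y`. -/
def IOf (y : Pt → Fin 3 → ℝ) (p : Pt) : Matrix (Fin 2) (Fin 2) ℝ :=
  (jac y p)ᵀ * jac y p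

/-- Second fundamental form matrix of a map `y` with respect to a unit normal `ν`. -/
def IIOf (y ν : Pt → Fin 3 → ℝ) (p : Pt) : Matrix (Fin 2) (Fin 2) ℝ :=
  -((jac y p)ᵀ * jac ν p)

/-- Weingarten matrix `α := −IIᵀ I⁻¹` of a map `y` with unit normal `ν`. -/
def weinOf (y ν : Pt → Fin 3 → ℝ) (p : Pt) : Matrix (Fin 2) (Fin 2) ℝ :=
  -((IIOf y ν p)ᵀ * (IOf y p)⁻¹)

/-- Gaussian curvature of an immersion `y` with unit normal `ν`. -/
def KgOf (y ν : Pt → Fin 3 → ℝ) (p : Pt) : ℝ :=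
  (IIOf y ν p).det / (IOf y p).det

/-- Mean curvature of an immersion `y` with unit normal `ν`. -/
def HmOf (y ν : Pt → Fin 3 → ℝ) (p : Pt) : ℝ :=
  -(1 / 2) * (weinOf y ν p).trace

/-- Smaller principal curvature `H − √(H² − K)` of an immersion `y`. -/
def k1Of (y ν : Pt → Fin 3 → ℝ) (p : Pt) : ℝ :=
  HmOf y ν p - Real.sqrt ((HmOf y ν p) ^ 2 - KgOf y ν p)

/-- Larger principal curvature `H + √(H² − K)` of an immersion `y`. -/
def k2Of (y ν : Pt → Fin 3 → ℝ) (p : Pt) : ℝ :=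
  HmOf y ν p + Real.sqrt ((HmOf y ν p) ^ 2 - KgOf y ν p)

/-- A frontal `x : U → ℝ³` equipped with a tangent moving base (tmb) `Ω` and the
induced smooth matrix-valued maps `Λ`, `μ` satisfying `Dx = Ω Λᵀ` and `Dn = Ω μᵀ` on `U`. -/
structure Frontal where
  /-- the domain -/
  U : Set Pt
  isOpen_U : IsOpen U
  /-- the frontal -/
  x : Pt → Fin 3 → ℝ
  /-- the tangent moving base -/
  Ω : Pt → Matrix (Fin 3) (Fin 2) ℝ
  /-- `Λ` with `Dx = Ω Λᵀ` -/
  Λ : Pt → Matrix (Fin 2) (Fin 2) ℝ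
  /-- `μ` with `Dn = Ω μᵀ` -/
  μ : Pt → Matrix (Fin 2) (Fin 2) ℝ
  smooth_x : ContDiffOn ℝ (⊤ : ℕ∞) x U
  smooth_Ω : ∀ i j, ContDiffOn ℝ (⊤ : ℕ∞) (fun p => Ω p i j) U
  smooth_Λ : ∀ i j, ContDiffOn ℝ (⊤ : ℕ∞) (fun p => Λ p i j) U
  smooth_μ : ∀ i j, ContDiffOn ℝ (⊤ : ℕ∞) (fun p => μ p i j) U
  /-- the columns of `Ω` are linearly independent (nonzero cross product) -/
  indep : ∀ p ∈ U, crossProduct (fun i => Ω p i 0) (fun i => Ω p i 1) ≠ 0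
  decomp_x : ∀ p ∈ U, jac x p = Ω p * (Λ p)ᵀ
  decomp_n : ∀ p ∈ U, jac (normalOf Ω) p = Ω p * (μ p)ᵀ

namespace Frontal

variable (F : Frontal)

/-- The unit normal induced by the tmb. -/
def n : Pt → Fin 3 → ℝ := normalOf F.Ω

/-- `λ_Ω := det Λ`. -/
def lam (p : Pt) : ℝ := (F.Λ p).det

/-- The Ω-relative curvature `K_Ω := det μ`. -/
def KΩ (p : Pt) : ℝ := (F.μ p).det

/-- `α_Ω := μ · adj(Λ)`. -/
def αΩ (p : Pt) : Matrix (Fin 2) (Fin 2) ℝ := F.μ p * (F.Λ p).adjugate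

/-- The Ω-relative mean curvature `H_Ω := −(1/2) tr α_Ω`. -/
def HΩ (p : Pt) : ℝ := -(1 / 2) * (F.αΩ p).trace

/-- The relative principal curvature `k_{1Ω} := H_Ω − √(H_Ω² − λ_Ω K_Ω)`. -/
def k1Ω (p : Pt) : ℝ := F.HΩ p - Real.sqrt ((F.HΩ p) ^ 2 - F.lam p * F.KΩ p)

/-- The relative principal curvature `k_{2Ω} := H_Ω + √(H_Ω² − λ_Ω K_Ω)`. -/
def k2Ω (p : Pt) : ℝ := F.HΩ p + Real.sqrt ((F.HΩ p) ^ 2 - F.lam p * F.KΩ p)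

/-- The singular set `Σ(x) = λ_Ω⁻¹(0)`. -/
def sing : Set Pt := {p ∈ F.U | F.lam p = 0}

/-- The regular set `U − Σ(x)`. -/
def reg : Set Pt := {p ∈ F.U | F.lam p ≠ 0}

/-- A frontal is proper if its singular set has empty interior. -/
def IsProper : Prop := interior F.sing = ∅

/-- `x` is a wavefront if `(x, n) : U → ℝ³ × S²` is an immersion. -/
def IsWavefront : Prop :=
  ∀ p ∈ F.U, (Matrix.fromRows (jac F.x p) (jac F.n p)).rank = 2

/-- First fundamental form matrix `I = Dxᵀ Dx`. -/
def Imat (p : Pt) : Matrix (Fin 2) (Fin 2) ℝ := IOf F.x p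

/-- Second fundamental form matrix `II = −Dxᵀ Dn`. -/
def IImat (p : Pt) : Matrix (Fin 2) (Fin 2) ℝ := IIOf F.x F.n p

/-- Weingarten matrix `α := −IIᵀ I⁻¹` (meaningful off the singular set). -/
def Wein (p : Pt) : Matrix (Fin 2) (Fin 2) ℝ := weinOf F.x F.n p

/-- Coefficient `e` of the second fundamental form. -/
def e (p : Pt) : ℝ := F.IImat p 0 0

/-- Coefficient `f` of the second fundamental form. -/
def f (p : Pt) : ℝ := F.IImat p 0 1

/-- Coefficient `g` of the second fundamental form. -/
def g (p : Pt) : ℝ := F.IImat p 1 1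

/-- Gaussian curvature (meaningful off the singular set). -/
def Kg (p : Pt) : ℝ := KgOf F.x F.n p

/-- Mean curvature (meaningful off the singular set). -/
def Hm (p : Pt) : ℝ := HmOf F.x F.n p

/-- Principal curvature `κ₋ := H − √(H² − K)`. -/
def κm (p : Pt) : ℝ := F.Hm p - Real.sqrt ((F.Hm p) ^ 2 - F.Kg p)

/-- Principal curvature `κ₊ := H + √(H² − K)`. -/
def κp (p : Pt) : ℝ := F.Hm p + Real.sqrt ((F.Hm p) ^ 2 - F.Kg p)

/-- `k₁ := κ₋` where `λ_Ω > 0` and `k₁ := κ₊` where `λ_Ω < 0`. -/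
def k1 (p : Pt) : ℝ := if 0 < F.lam p then F.κm p else F.κp p

/-- `k₂ := κ₊` where `λ_Ω > 0` and `k₂ := κ₋` where `λ_Ω < 0`. -/
def k2 (p : Pt) : ℝ := if 0 < F.lam p then F.κp p else F.κm p

/-- `x` is parallelly smoothable at `p` : for some `ε > 0` and some open
neighborhood `V` of `p`, `rank D(x + l·n)(q) = 2` for all `(q,l) ∈ V × (0,ε)`
or for all `(q,l) ∈ V × (−ε,0)`. -/
def ParSmoothable (p : Pt) : Prop :=
  ∃ ε > (0 : ℝ), ∃ V : Set Pt, IsOpen V ∧ p ∈ V ∧ V ⊆ F.U ∧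
    ((∀ q ∈ V, ∀ l ∈ Set.Ioo (0 : ℝ) ε,
        (jac (fun z => F.x z + l • F.n z) q).rank = 2) ∨
     (∀ q ∈ V, ∀ l ∈ Set.Ioo (-ε) (0 : ℝ),
        (jac (fun z => F.x z + l • F.n z) q).rank = 2))

/-- `f` (defined off the singular set) has a `C^∞` extension to `V`. -/
def SmoothExtOn (f : Pt → ℝ) (V : Set Pt) : Prop :=
  ∃ g : Pt → ℝ, ContDiffOn ℝ (⊤ : ℕ∞) g V ∧ ∀ q ∈ V ∩ F.reg, g q = f q

/-- `f` has a `C^∞` extension to some open neighborhood of `p`. -/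
def SmoothExtNear (f : Pt → ℝ) (p : Pt) : Prop :=
  ∃ V : Set Pt, IsOpen V ∧ p ∈ V ∧ V ⊆ F.U ∧ F.SmoothExtOn f V

/-- Membership in the principal ideal `𝔗_Ω(V)` generated by `λ_Ω` in `C^∞(V,ℝ)`. -/
def memIdeal (f : Pt → ℝ) (V : Set Pt) : Prop :=
  ∃ φ : Pt → ℝ, ContDiffOn ℝ (⊤ : ℕ∞) φ V ∧ ∀ q ∈ V, f q = φ q * F.lam q

end Frontal

/-- `f` does not change sign on `V`. -/
def NoSignChange (f : Pt → ℝ) (V : Set Pt) : Prop :=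
  (∀ q ∈ V, 0 ≤ f q) ∨ (∀ q ∈ V, f q ≤ 0)

theorem rank_eq_two_iff_det_ne_zero (A : Matrix (Fin 2) (Fin 2) ℝ) :
    A.rank = 2 ↔ A.det ≠ 0 := by
  constructor
  · intro h
    have hli : LinearIndependent ℝ A.col := by
      rw [linearIndependent_iff_card_eq_finrank_span, Set.finrank,
        ← Matrix.rank_eq_finrank_span_cols, h, Fintype.card_fin]
    have hu := Matrix.linearIndependent_cols_iff_isUnit.1 hli
    exact ((Matrix.isUnit_iff_isUnit_det A).1 hu).ne_zero
  · intro h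
    simpa using Matrix.rank_of_det_ne_zero h

/-- Lagrange's identity: the Gram determinant of two vectors of `ℝ³` is the squared norm of their
cross product. -/
theorem det_gram_eq_cross_dot_cross (A : Matrix (Fin 3) (Fin 2) ℝ) :
    (Aᵀ * A).det = crossProduct (fun i => A i 0) (fun i => A i 1) ⬝ᵥ
      crossProduct (fun i => A i 0) (fun i => A i 1) := by
  rw [cross_dot_cross, Matrix.det_fin_two]
  simp only [Matrix.mul_apply, Matrix.transpose_apply, dotProduct]

theorem det_gram_ne_zero {A : Matrix (Fin 3) (Fin 2) ℝ}
    (h : crossProduct (fun i => A i 0) (fun i => A i 1) ≠ 0) : (Aᵀ * A).det ≠ 0 := by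
  rwa [det_gram_eq_cross_dot_cross, ne_eq, dotProduct_self_eq_zero]

/-- Right multiplication of a matrix with independent columns by `Mᵀ` has full rank exactly
when `M` is invertible. -/
theorem rank_mul_transpose_eq_two_iff {A : Matrix (Fin 3) (Fin 2) ℝ}
    (h : crossProduct (fun i => A i 0) (fun i => A i 1) ≠ 0) (M : Matrix (Fin 2) (Fin 2) ℝ) :
    (A * Mᵀ).rank = 2 ↔ M.det ≠ 0 := by
  have hG := det_gram_ne_zero h
  have heq : (A * Mᵀ)ᵀ * (A * Mᵀ) = M * (Aᵀ * A) * Mᵀ := by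
    simp only [Matrix.transpose_mul, Matrix.transpose_transpose, Matrix.mul_assoc]
  rw [← Matrix.rank_transpose_mul_self, rank_eq_two_iff_det_ne_zero, heq, Matrix.det_mul,
    Matrix.det_mul, Matrix.det_transpose]
  simp [hG]

/-- A quotient `f / lam` with `f p ≠ 0` and `lam p = 0` diverges with a definite sign exactly when
`lam` does not change sign near `p`. -/
theorem tendsto_div_atTop_or_atBot_iff {X : Type*} [TopologicalSpace X] {p : X} {U : Set X}
    {lam f g : X → ℝ} (hU : U ∈ 𝓝 p) (hlam : ContinuousAt lam p) (hf : ContinuousAt f p)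
    (hlam0 : lam p = 0) (hf0 : f p ≠ 0)
    (hg : g =ᶠ[𝓝[{q ∈ U | lam q ≠ 0}] p] fun q => f q / lam q) :
    (Tendsto g (𝓝[{q ∈ U | lam q ≠ 0}] p) atTop ∨ Tendsto g (𝓝[{q ∈ U | lam q ≠ 0}] p) atBot) ↔
      ((∀ᶠ q in 𝓝 p, 0 ≤ lam q) ∨ ∀ᶠ q in 𝓝 p, lam q ≤ 0) := by
  wlog hpos : 0 < f p generalizing f g
  · have key := this (f := fun q => -f q) (g := fun q => -g q) hf.neg (neg_ne_zero.2 hf0)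
      (by filter_upwards [hg] with q hq; rw [hq, neg_div])
      (neg_pos.2 (lt_of_le_of_ne (not_lt.1 hpos) hf0))
    rw [tendsto_neg_atTop_iff, tendsto_neg_atBot_iff] at key
    rw [or_comm, key]
  set l := 𝓝[{q ∈ U | lam q ≠ 0}] p with hl
  have hlamt : Tendsto lam l (𝓝 0) := hlam0 ▸ hlam.tendsto.mono_left nhdsWithin_le_nhds
  have hft : Tendsto f l (𝓝 (f p)) := hf.tendsto.mono_left nhdsWithin_le_nhds
  have hne : ∀ᶠ q in l, lam q ≠ 0 := by
    filter_upwards [self_mem_nhdsWithin] with q hq using hq.2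
  have hfpos : ∀ᶠ q in l, 0 < f q := hft.eventually (lt_mem_nhds hpos)
  rw [tendsto_congr' hg, tendsto_congr' hg]
  simp only [div_eq_mul_inv]
  constructor
  · rintro (h | h)
    · left
      have hev : ∀ᶠ q in l, 0 < lam q := by
        filter_upwards [hfpos, h.eventually_gt_atTop 0] with q h1 h2
        exact inv_pos.1 (pos_of_mul_pos_right h2 h1.le)
      filter_upwards [eventually_nhdsWithin_iff.1 hev, hU] with q h1 h2
      by_contra hq
      exact hq (h1 ⟨h2, (not_le.1 hq).ne⟩).le
    · right
      have hev : ∀ᶠ q in l, lam q < 0 := by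
        filter_upwards [hfpos, h.eventually_lt_atBot 0] with q h1 h2
        exact inv_lt_zero.1 (neg_of_mul_neg_right h2 h1.le)
      filter_upwards [eventually_nhdsWithin_iff.1 hev, hU] with q h1 h2
      by_contra hq
      exact hq (h1 ⟨h2, (not_le.1 hq).ne'⟩).le
  · rintro (h | h)
    · left
      refine hft.pos_mul_atTop hpos (tendsto_inv_nhdsGT_zero.comp
        (tendsto_nhdsWithin_iff.2 ⟨hlamt, ?_⟩))
      filter_upwards [hne, nhdsWithin_le_nhds h] with q h1 h2 using lt_of_le_of_ne h2 h1.symm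
    · right
      refine hft.pos_mul_atBot hpos (tendsto_inv_nhdsLT_zero.comp
        (tendsto_nhdsWithin_iff.2 ⟨hlamt, ?_⟩))
      filter_upwards [hne, nhdsWithin_le_nhds h] with q h1 h2 using lt_of_le_of_ne h2 h1

/-- For `H p < 0` and `lam p = 0`, the quadratics `l ↦ lam q - 2 l H q + l² K q` have no small
positive root, locally uniformly in `q`, exactly when `lam` is nonnegative near `p`. -/
theorem eventually_quadratic_ne_zero_iff {X : Type*} [TopologicalSpace X] {p : X}
    {lam H K : X → ℝ} (hlam : ContinuousAt lam p) (hHc : ContinuousAt H p)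
    (hKc : ContinuousAt K p) (hlam0 : lam p = 0) (hH : H p < 0) :
    (∃ ε > 0, ∀ᶠ q in 𝓝 p, ∀ l ∈ Set.Ioo (0 : ℝ) ε, lam q - 2 * l * H q + l ^ 2 * K q ≠ 0) ↔
      ∀ᶠ q in 𝓝 p, 0 ≤ lam q := by
  constructor
  · rintro ⟨ε, hε, hev⟩
    obtain ⟨l, hl, hlpos⟩ : ∃ l ∈ Set.Ioo 0 ε, 0 < -2 * H p + l * K p := by
      have hcont : ContinuousAt (fun l : ℝ => -2 * H p + l * K p) 0 := by fun_prop
      have h1 : ∀ᶠ l in 𝓝[>] (0 : ℝ), 0 < -2 * H p + l * K p :=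
        nhdsWithin_le_nhds (hcont.eventually (lt_mem_nhds (by linarith)))
      have h2 : ∀ᶠ l in 𝓝[>] (0 : ℝ), l ∈ Set.Ioo 0 ε := Ioo_mem_nhdsGT hε
      exact (h2.and h1).exists
    have hcont : ContinuousAt (fun q => lam q - 2 * l * H q + l ^ 2 * K q) p := by fun_prop
    have hpos : 0 < lam p - 2 * l * H p + l ^ 2 * K p := by
      rw [hlam0]
      nlinarith [mul_pos hl.1 hlpos]
    filter_upwards [hev, hcont.eventually (lt_mem_nhds hpos)] with q h1 h2
    by_contra hneg
    obtain ⟨t, ht, ht0⟩ := intermediate_value_Ioo (f := fun t => lam q - 2 * t * H q + t ^ 2 * K q)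
      hl.1.le (by fun_prop) (show (0 : ℝ) ∈ Set.Ioo _ _ from ⟨by simpa using hneg, h2⟩)
    exact h1 t ⟨ht.1, ht.2.trans hl.2⟩ ht0
  · intro hev
    have hB : 0 < |K p| + 1 := by positivity
    have hK : ∀ᶠ q in 𝓝 p, |K q| < |K p| + 1 :=
      hKc.abs.eventually (gt_mem_nhds (lt_add_one _))
    have hH' : ∀ᶠ q in 𝓝 p, H q < H p / 2 := hHc.eventually (gt_mem_nhds (by linarith))
    refine ⟨-H p / (|K p| + 1), div_pos (by linarith) hB, ?_⟩
    filter_upwards [hev, hK, hH'] with q h1 h2 h3 l hl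
    have h4 := (lt_div_iff₀ hB).1 hl.2
    have h5 := mul_le_mul_of_nonneg_left ((neg_abs_le (K q)).trans' (neg_le_neg h2.le)) hl.1.le
    have h6 : 0 < l * (-2 * H q + l * K q) := mul_pos hl.1 (by linarith)
    nlinarith

theorem exists_noSignChange_iff {f : Pt → ℝ} {p : Pt} {U : Set Pt} (hU : U ∈ 𝓝 p) :
    (∃ V : Set Pt, IsOpen V ∧ p ∈ V ∧ V ⊆ U ∧ NoSignChange f V) ↔
      ((∀ᶠ q in 𝓝 p, 0 ≤ f q) ∨ ∀ᶠ q in 𝓝 p, f q ≤ 0) := by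
  constructor
  · rintro ⟨V, hV, hpV, -, h | h⟩
    · exact Or.inl (mem_of_superset (hV.mem_nhds hpV) h)
    · exact Or.inr (mem_of_superset (hV.mem_nhds hpV) h)
  · rintro (h | h)
    · obtain ⟨V, hVs, hV, hpV⟩ := mem_nhds_iff.1 (inter_mem hU h)
      exact ⟨V, hV, hpV, fun q hq => (hVs hq).1, Or.inl fun q hq => (hVs hq).2⟩
    · obtain ⟨V, hVs, hV, hpV⟩ := mem_nhds_iff.1 (inter_mem hU h)
      exact ⟨V, hV, hpV, fun q hq => (hVs hq).1, Or.inr fun q hq => (hVs hq).2⟩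

namespace Frontal

variable {F : Frontal} {p : Pt}

theorem continuousAt_Λ (hp : p ∈ F.U) (i j : Fin 2) : ContinuousAt (fun q => F.Λ q i j) p :=
  (F.smooth_Λ i j).continuousOn.continuousAt (F.isOpen_U.mem_nhds hp)

theorem continuousAt_μ (hp : p ∈ F.U) (i j : Fin 2) : ContinuousAt (fun q => F.μ q i j) p :=
  (F.smooth_μ i j).continuousOn.continuousAt (F.isOpen_U.mem_nhds hp)

theorem continuousAt_lam (hp : p ∈ F.U) : ContinuousAt F.lam p := by
  have h := F.continuousAt_Λ hp
  rw [show F.lam = _ from funext fun q => Matrix.det_fin_two (F.Λ q)]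
  exact ((h 0 0).mul (h 1 1)).sub ((h 0 1).mul (h 1 0))

theorem continuousAt_KΩ (hp : p ∈ F.U) : ContinuousAt F.KΩ p := by
  have h := F.continuousAt_μ hp
  rw [show F.KΩ = _ from funext fun q => Matrix.det_fin_two (F.μ q)]
  exact ((h 0 0).mul (h 1 1)).sub ((h 0 1).mul (h 1 0))

theorem HΩ_eq (F : Frontal) (q : Pt) : F.HΩ q = -(1 / 2) *
    (F.μ q 0 0 * F.Λ q 1 1 - F.μ q 0 1 * F.Λ q 1 0
      + (F.μ q 1 1 * F.Λ q 0 0 - F.μ q 1 0 * F.Λ q 0 1)) := by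
  simp only [HΩ, αΩ, Matrix.trace_fin_two, Matrix.adjugate_fin_two, Matrix.mul_apply,
    Fin.sum_univ_two, Matrix.of_apply, Matrix.cons_val', Matrix.cons_val_zero, Matrix.cons_val_one,
    Matrix.cons_val_fin_one]
  ring

theorem continuousAt_HΩ (hp : p ∈ F.U) : ContinuousAt F.HΩ p := by
  have h := F.continuousAt_Λ hp
  have h' := F.continuousAt_μ hp
  rw [funext F.HΩ_eq]
  exact continuousAt_const.mul ((((h' 0 0).mul (h 1 1)).sub ((h' 0 1).mul (h 1 0))).add
    (((h' 1 1).mul (h 0 0)).sub ((h' 1 0).mul (h 0 1))))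

/-- The characteristic polynomial expansion `det (Λ + l μ) = λ_Ω - 2 l H_Ω + l² K_Ω`. -/
theorem det_Λ_add_smul_μ (F : Frontal) (q : Pt) (l : ℝ) :
    (F.Λ q + l • F.μ q).det = F.lam q - 2 * l * F.HΩ q + l ^ 2 * F.KΩ q := by
  rw [HΩ_eq, lam, KΩ]
  simp only [Matrix.det_fin_two, Matrix.add_apply, Matrix.smul_apply, smul_eq_mul]
  ring

theorem differentiableAt_n (hp : p ∈ F.U) : DifferentiableAt ℝ F.n p := by
  have hΩ : ∀ i j, DifferentiableAt ℝ (fun q => F.Ω q i j) p := fun i j =>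
    ((F.smooth_Ω i j).differentiableOn (by simp)).differentiableAt (F.isOpen_U.mem_nhds hp)
  have hc : DifferentiableAt ℝ
      (fun q => crossProduct (fun i => F.Ω q i 0) (fun i => F.Ω q i 1)) p := by
    rw [differentiableAt_pi]
    intro i
    fin_cases i <;>
      exact ((hΩ _ _).mul (hΩ _ _)).sub ((hΩ _ _).mul (hΩ _ _))
  have hd : DifferentiableAt ℝ
      (fun q => crossProduct (fun i => F.Ω q i 0) (fun i => F.Ω q i 1) ⬝ᵥ
        crossProduct (fun i => F.Ω q i 0) (fun i => F.Ω q i 1)) p := by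
    simp only [dotProduct]
    exact DifferentiableAt.fun_sum fun i _ =>
      (differentiableAt_pi.1 hc i).mul (differentiableAt_pi.1 hc i)
  have hne := F.indep p hp
  have hd0 := mt dotProduct_self_eq_zero.1 hne
  have hs : enorm3 (crossProduct (fun i => F.Ω p i 0) (fun i => F.Ω p i 1)) ≠ 0 := by
    rw [enorm3, ne_eq, Real.sqrt_eq_zero']
    exact not_le.2 (lt_of_le_of_ne (Finset.sum_nonneg fun i _ => mul_self_nonneg _) (Ne.symm hd0))
  exact ((hd.sqrt hd0).inv hs).smul hc

theorem jac_parallel (hp : p ∈ F.U) (l : ℝ) :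
    jac (fun z => F.x z + l • F.n z) p = F.Ω p * (F.Λ p + l • F.μ p)ᵀ := by
  have hx : DifferentiableAt ℝ F.x p :=
    (F.smooth_x.differentiableOn (by simp)).differentiableAt (F.isOpen_U.mem_nhds hp)
  have hn := F.differentiableAt_n hp
  have hjac : jac (fun z => F.x z + l • F.n z) p = jac F.x p + l • jac F.n p := by
    ext i j
    simp only [jac, Matrix.of_apply, Matrix.add_apply, Matrix.smul_apply]
    rw [fderiv_fun_add hx (hn.fun_const_smul l), fderiv_fun_const_smul hn]
    rfl
  rw [hjac, F.decomp_x p hp, show jac F.n p = _ from F.decomp_n p hp, Matrix.transpose_add,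
    Matrix.transpose_smul, Matrix.mul_add, Matrix.mul_smul]

theorem rank_jac_parallel_eq_two_iff (hp : p ∈ F.U) (l : ℝ) :
    (jac (fun z => F.x z + l • F.n z) p).rank = 2 ↔
      F.lam p - 2 * l * F.HΩ p + l ^ 2 * F.KΩ p ≠ 0 := by
  rw [jac_parallel hp, rank_mul_transpose_eq_two_iff (F.indep p hp), det_Λ_add_smul_μ]

theorem IOf_eq (hp : p ∈ F.U) :
    IOf F.x p = F.Λ p * ((F.Ω p)ᵀ * F.Ω p) * (F.Λ p)ᵀ := by
  rw [IOf, F.decomp_x p hp]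
  simp only [Matrix.transpose_mul, Matrix.transpose_transpose, Matrix.mul_assoc]

theorem IIOf_eq (hp : p ∈ F.U) :
    IIOf F.x F.n p = -(F.Λ p * ((F.Ω p)ᵀ * F.Ω p) * (F.μ p)ᵀ) := by
  rw [IIOf, F.decomp_x p hp, show jac F.n p = _ from F.decomp_n p hp]
  simp only [Matrix.transpose_mul, Matrix.transpose_transpose, Matrix.mul_assoc]

theorem Kg_eq (hp : p ∈ F.reg) : F.Kg p = F.KΩ p / F.lam p := by
  have hG := det_gram_ne_zero (F.indep p hp.1)
  have hl : (F.Λ p).det ≠ 0 := hp.2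
  rw [Kg, KgOf, IOf_eq hp.1, IIOf_eq hp.1, Matrix.det_neg, KΩ, lam]
  simp only [Matrix.det_mul (_ * _) (_)ᵀ, Matrix.det_mul (F.Λ p), Matrix.det_transpose,
    Fintype.card_fin]
  field_simp

theorem Hm_eq (hp : p ∈ F.reg) : F.Hm p = F.HΩ p / F.lam p := by
  have hG : IsUnit ((F.Ω p)ᵀ * F.Ω p).det := (det_gram_ne_zero (F.indep p hp.1)).isUnit
  have hl : IsUnit (F.Λ p).det := (hp.2 : (F.Λ p).det ≠ 0).isUnit
  have hlt : IsUnit ((F.Λ p)ᵀ).det := by rwa [Matrix.det_transpose]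
  have hW : weinOf F.x F.n p = F.μ p * (F.Λ p)⁻¹ := by
    rw [weinOf, IOf_eq hp.1, IIOf_eq hp.1]
    simp only [Matrix.transpose_neg, Matrix.neg_mul, neg_neg]
    rw [Matrix.mul_inv_rev, Matrix.mul_inv_rev, Matrix.transpose_mul, Matrix.transpose_mul,
      Matrix.transpose_transpose, Matrix.transpose_mul (F.Ω p)ᵀ, Matrix.transpose_transpose]
    set G := (F.Ω p)ᵀ * F.Ω p
    calc F.μ p * (G * (F.Λ p)ᵀ) * ((F.Λ p)ᵀ⁻¹ * (G⁻¹ * (F.Λ p)⁻¹))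
        = F.μ p * (G * ((F.Λ p)ᵀ * (F.Λ p)ᵀ⁻¹) * G⁻¹) * (F.Λ p)⁻¹ := by
          simp only [Matrix.mul_assoc]
      _ = F.μ p * (F.Λ p)⁻¹ := by
          rw [Matrix.mul_nonsing_inv _ hlt, Matrix.mul_one, Matrix.mul_nonsing_inv _ hG,
            Matrix.mul_one]
  rw [Hm, HmOf, hW, Matrix.inv_def, Matrix.mul_smul, Matrix.trace_smul, Ring.inverse_eq_inv',
    HΩ, αΩ, lam, smul_eq_mul]
  ring

theorem k1_eq (hp : p ∈ F.reg) : F.k1 p = F.k1Ω p / F.lam p := by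
  have hl : F.lam p ≠ 0 := hp.2
  have hdisc : (F.Hm p) ^ 2 - F.Kg p =
      ((F.HΩ p) ^ 2 - F.lam p * F.KΩ p) / (F.lam p) ^ 2 := by
    rw [Hm_eq hp, Kg_eq hp]
    field_simp
  rw [k1, κm, κp, hdisc, Real.sqrt_div' _ (sq_nonneg _), Real.sqrt_sq_eq_abs, Hm_eq hp, k1Ω]
  split_ifs with h
  · rw [abs_of_pos h]
    ring
  · rw [abs_of_neg (lt_of_le_of_ne (not_lt.1 h) hl), div_neg]
    ring

theorem parSmoothable_iff (hp : p ∈ F.sing) (hH : F.HΩ p < 0) :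
    F.ParSmoothable p ↔ ((∀ᶠ q in 𝓝 p, 0 ≤ F.lam q) ∨ ∀ᶠ q in 𝓝 p, F.lam q ≤ 0) := by
  have hU : F.U ∈ 𝓝 p := F.isOpen_U.mem_nhds hp.1
  have hlamc := F.continuousAt_lam hp.1
  have hHc := F.continuousAt_HΩ hp.1
  have hKc := F.continuousAt_KΩ hp.1
  have hpos := eventually_quadratic_ne_zero_iff hlamc hHc hKc hp.2 hH
  have hneg := eventually_quadratic_ne_zero_iff (lam := fun q => -F.lam q) (K := fun q => -F.KΩ q)
    hlamc.neg hHc hKc.neg (neg_eq_zero.2 hp.2) hH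
  have hsymm : ∀ q l, -F.lam q - 2 * l * F.HΩ q + l ^ 2 * -F.KΩ q =
      -(F.lam q - 2 * -l * F.HΩ q + (-l) ^ 2 * F.KΩ q) := fun q l => by ring
  simp only [neg_nonneg] at hneg
  rw [← hpos, ← hneg]
  constructor
  · rintro ⟨ε, hε, V, hV, hpV, hVU, h | h⟩
    · left
      refine ⟨ε, hε, ?_⟩
      filter_upwards [hV.mem_nhds hpV] with q hq l hl
      exact (rank_jac_parallel_eq_two_iff (hVU hq) l).1 (h q hq l hl)
    · right
      refine ⟨ε, hε, ?_⟩
      filter_upwards [hV.mem_nhds hpV] with q hq l hl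
      rw [hsymm, neg_ne_zero]
      exact (rank_jac_parallel_eq_two_iff (hVU hq) (-l)).1
        (h q hq (-l) ⟨neg_lt_neg hl.2, neg_neg_of_pos hl.1⟩)
  · rintro (⟨ε, hε, h⟩ | ⟨ε, hε, h⟩)
    · obtain ⟨V, hVs, hV, hpV⟩ := mem_nhds_iff.1 (inter_mem hU h)
      exact ⟨ε, hε, V, hV, hpV, fun q hq => (hVs hq).1, Or.inl fun q hq l hl =>
        (rank_jac_parallel_eq_two_iff (hVs hq).1 l).2 ((hVs hq).2 l hl)⟩
    · obtain ⟨V, hVs, hV, hpV⟩ := mem_nhds_iff.1 (inter_mem hU h)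
      refine ⟨ε, hε, V, hV, hpV, fun q hq => (hVs hq).1, Or.inr fun q hq l hl =>
        (rank_jac_parallel_eq_two_iff (hVs hq).1 l).2 ?_⟩
      have h' := (hVs hq).2 (-l) ⟨neg_pos.2 hl.2, neg_lt.1 hl.1⟩
      rwa [hsymm, neg_ne_zero, neg_neg] at h'

theorem continuousAt_k1Ω (hp : p ∈ F.U) : ContinuousAt F.k1Ω p := by
  have hlamc := F.continuousAt_lam hp
  have hHc := F.continuousAt_HΩ hp
  have hKc := F.continuousAt_KΩ hp
  exact hHc.sub ((hHc.pow 2).sub (hlamc.mul hKc)).sqrt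

/-- Where `H_Ω < 0`, the sign of `k_{2Ω}` is opposite to that of `λ_Ω K_Ω`. -/
theorem k2Ω_sign {q : Pt} (hH : F.HΩ q < 0) :
    (0 ≤ F.k2Ω q ↔ F.lam q * F.KΩ q ≤ 0) ∧ (F.k2Ω q ≤ 0 ↔ 0 ≤ F.lam q * F.KΩ q) := by
  have hneg : 0 ≤ -F.HΩ q := by linarith
  constructor
  · rw [k2Ω, ← neg_le_iff_add_nonneg', Real.le_sqrt' (neg_pos.2 hH), neg_sq]
    constructor <;> intro h <;> linarith
  · rw [k2Ω, ← le_neg_iff_add_nonpos_left, Real.sqrt_le_left hneg, neg_sq]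
    constructor <;> intro h <;> linarith

theorem k2Ω_eventually_sign_iff (hp : p ∈ F.U) (hK : F.KΩ p ≠ 0) (hH : F.HΩ p < 0) :
    ((∀ᶠ q in 𝓝 p, 0 ≤ F.k2Ω q) ∨ ∀ᶠ q in 𝓝 p, F.k2Ω q ≤ 0) ↔
      ((∀ᶠ q in 𝓝 p, 0 ≤ F.lam q) ∨ ∀ᶠ q in 𝓝 p, F.lam q ≤ 0) := by
  have hHev := (F.continuousAt_HΩ hp).eventually (gt_mem_nhds hH)
  rcases lt_or_gt_of_ne hK with hK | hK
  · have hKev := (F.continuousAt_KΩ hp).eventually (gt_mem_nhds hK)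
    refine or_congr (eventually_congr ?_) (eventually_congr ?_) <;>
      filter_upwards [hHev, hKev] with q h1 h2
    · rw [(k2Ω_sign h1).1, mul_nonpos_iff_pos_imp_nonpos]
      grind
    · rw [(k2Ω_sign h1).2]
      exact ⟨fun h => nonpos_of_mul_nonneg_left h h2, fun h => mul_nonneg_of_nonpos_of_nonpos h h2.le⟩
  · have hKev := (F.continuousAt_KΩ hp).eventually (lt_mem_nhds hK)
    rw [or_comm]
    refine or_congr (eventually_congr ?_) (eventually_congr ?_) <;>
      filter_upwards [hHev, hKev] with q h1 h2
    · rw [(k2Ω_sign h1).2, mul_nonneg_iff_of_pos_right h2]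
    · rw [(k2Ω_sign h1).1, mul_nonpos_iff_pos_imp_nonpos]
      grind

end Frontal

/-- at a rank-1 singularity with `K_Ω(p) ≠ 0` and `H_Ω(p) < 0`,
parallel smoothability is equivalent to divergence of `H`, of `k₁`, of `K`, and
to `λ_Ω` (resp. `k_{2Ω}`) not changing sign near `p`. -/
theorem stmt12 (F : Frontal) (hW : F.IsWavefront)
    (p : Pt) (hp : p ∈ F.sing) (hr : (jac F.x p).rank = 1)
    (hK : F.KΩ p ≠ 0) (hH : F.HΩ p < 0) :
    List.TFAE [
      F.ParSmoothable p,
      Tendsto F.Hm (nhdsWithin p F.reg) atTop ∨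
        Tendsto F.Hm (nhdsWithin p F.reg) atBot,
      Tendsto F.k1 (nhdsWithin p F.reg) atTop ∨
        Tendsto F.k1 (nhdsWithin p F.reg) atBot,
      Tendsto F.Kg (nhdsWithin p F.reg) atTop ∨
        Tendsto F.Kg (nhdsWithin p F.reg) atBot,
      ∃ V : Set Pt, IsOpen V ∧ p ∈ V ∧ V ⊆ F.U ∧ NoSignChange F.lam V,
      ∃ V : Set Pt, IsOpen V ∧ p ∈ V ∧ V ⊆ F.U ∧ NoSignChange F.k2Ω V] := by
  have hU : F.U ∈ 𝓝 p := F.isOpen_U.mem_nhds hp.1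
  have hlamc := F.continuousAt_lam hp.1
  have hk1 : F.k1Ω p ≠ 0 :=
    (sub_neg.2 (hH.trans_le (Real.sqrt_nonneg _))).ne
  have on_reg {f g : Pt → ℝ} (h : ∀ q ∈ F.reg, g q = f q) : g =ᶠ[𝓝[F.reg] p] f := by
    filter_upwards [self_mem_nhdsWithin] with q hq using h q hq
  tfae_have 1 ↔ 5 := (Frontal.parSmoothable_iff hp hH).trans (exists_noSignChange_iff hU).symm
  tfae_have 2 ↔ 5 := (tendsto_div_atTop_or_atBot_iff hU hlamc (F.continuousAt_HΩ hp.1) hp.2 hH.ne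
    (on_reg fun _ hq => F.Hm_eq hq)).trans (exists_noSignChange_iff hU).symm
  tfae_have 3 ↔ 5 := (tendsto_div_atTop_or_atBot_iff hU hlamc (F.continuousAt_k1Ω hp.1) hp.2 hk1
    (on_reg fun _ hq => F.k1_eq hq)).trans (exists_noSignChange_iff hU).symm
  tfae_have 4 ↔ 5 := (tendsto_div_atTop_or_atBot_iff hU hlamc (F.continuousAt_KΩ hp.1) hp.2 hK
    (on_reg fun _ hq => F.Kg_eq hq)).trans (exists_noSignChange_iff hU).symm
  tfae_have 6 ↔ 5 := by
    rw [exists_noSignChange_iff hU, exists_noSignChange_iff hU,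
      Frontal.k2Ω_eventually_sign_iff hp.1 hK hH]
  tfae_finish
end
end

section
/- Let x : U → ℝ³ be a wavefront, Ω a tmb of x, and p ∈ Σ(x) with rank(Dx(p)) = 1. If x is parallelly smoothable at p, then p is a degenerated singularity, i.e. Dλ_Ω(p) = (0,0). -/
/- Common framework for frontals and tangent moving bases, following
   "Curvatures on fronts" conventions. -/

noncomputable section

open Matrix Topology Filter

lemma jac_add_smul {m : ℕ} {f g : Pt → (Fin m → ℝ)} {q : Pt} (l : ℝ)
    (hf : DifferentiableAt ℝ f q) (hg : DifferentiableAt ℝ g q) :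
    jac (fun z => f z + l • g z) q = jac f q + l • jac g q := by
  ext i j
  have h := (hf.hasFDerivAt.add (hg.hasFDerivAt.const_smul l)).fderiv
  have h' : fderiv ℝ (fun z => f z + l • g z) q = fderiv ℝ f q + l • fderiv ℝ g q := h
  simp [jac, h']

lemma differentiableAt_normalOf {Ω : Pt → Matrix (Fin 3) (Fin 2) ℝ} {q : Pt}
    (hΩ : ∀ i j, DifferentiableAt ℝ (fun p => Ω p i j) q)
    (hq : crossProduct (fun i => Ω q i 0) (fun i => Ω q i 1) ≠ 0) :
    DifferentiableAt ℝ (normalOf Ω) q := by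
  have hc : DifferentiableAt ℝ
      (fun p => crossProduct (fun i => Ω p i 0) (fun i => Ω p i 1)) q := by
    rw [differentiableAt_pi]
    intro i
    fin_cases i <;> simp [cross_apply] <;> fun_prop
  have hci := differentiableAt_pi.1 hc
  have hd : DifferentiableAt ℝ
      (fun p => crossProduct (fun i => Ω p i 0) (fun i => Ω p i 1) ⬝ᵥ
        crossProduct (fun i => Ω p i 0) (fun i => Ω p i 1)) q := by
    simp only [dotProduct]
    exact DifferentiableAt.fun_sum fun i _ => (hci i).mul (hci i)
  have hne : crossProduct (fun i => Ω q i 0) (fun i => Ω q i 1) ⬝ᵥ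
      crossProduct (fun i => Ω q i 0) (fun i => Ω q i 1) ≠ 0 :=
    fun h => hq (dotProduct_self_eq_zero.1 h)
  have hpos := lt_of_le_of_ne
    (Finset.sum_nonneg fun i _ => mul_self_nonneg _) hne.symm
  exact ((hd.sqrt hne).inv (Real.sqrt_pos.2 hpos).ne').smul hc

lemma Frontal.det_ne_zero_of_rank_jac_parallel (F : Frontal) {q : Pt} (hq : q ∈ F.U) {l : ℝ}
    (h : (jac (fun z => F.x z + l • F.n z) q).rank = 2) :
    (F.Λ q + l • F.μ q).det ≠ 0 := by
  have hU := F.isOpen_U.mem_nhds hq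
  have hx : DifferentiableAt ℝ F.x q :=
    (F.smooth_x.contDiffAt hU).differentiableAt (by simp)
  have hn : DifferentiableAt ℝ F.n q := differentiableAt_normalOf
    (fun i j => ((F.smooth_Ω i j).contDiffAt hU).differentiableAt (by simp)) (F.indep q hq)
  have hj : jac (fun z => F.x z + l • F.n z) q = F.Ω q * (F.Λ q + l • F.μ q)ᵀ := by
    rw [jac_add_smul l hx hn, F.decomp_x q hq, show jac F.n q = _ from F.decomp_n q hq,
      transpose_add, transpose_smul, Matrix.mul_add, Matrix.mul_smul]
  intro h0
  have h2 : 2 ≤ (F.Λ q + l • F.μ q)ᵀ.rank := by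
    rw [hj] at h
    exact h.ge.trans (rank_mul_le_right _ _)
  obtain ⟨v, hv, hv0⟩ := exists_mulVec_eq_zero_iff.2 ((det_transpose _).trans h0)
  have hr := LinearMap.finrank_range_add_finrank_ker (F.Λ q + l • F.μ q)ᵀ.mulVecLin
  have hk : 0 < Module.finrank ℝ (LinearMap.ker (F.Λ q + l • F.μ q)ᵀ.mulVecLin) :=
    Module.finrank_pos_iff_exists_ne_zero.2 ⟨⟨v, hv0⟩, fun h => hv (congrArg Subtype.val h)⟩
  rw [Module.finrank_fin_fun] at hr
  rw [Matrix.rank] at h2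
  lia

/-- If the family `det (Λ + l μ)` vanishes nowhere for `q` near `p` and `l` in an interval
adherent to `0`, then `det Λ` does not change sign near `p`. -/
lemma Frontal.fderiv_lam_eq_zero_of_det_ne_zero (F : Frontal) {p : Pt} (hp : p ∈ F.sing)
    {V : Set Pt} (hV : IsOpen V) (hpV : p ∈ V) (hVU : V ⊆ F.U) {S : Set ℝ} (hS : Convex ℝ S)
    (hS0 : (0 : ℝ) ∈ closure S)
    (h : ∀ q ∈ V, ∀ l ∈ S, (F.Λ q + l • F.μ q).det ≠ 0) :
    fderiv ℝ F.lam p = 0 := by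
  obtain ⟨r, hr, hB⟩ := Metric.isOpen_iff.1 hV p hpV
  have hcont : ContinuousOn (fun z : Pt × ℝ => (F.Λ z.1 + z.2 • F.μ z.1).det)
      (Metric.ball p r ×ˢ S) := by
    have hfst : Set.MapsTo Prod.fst (Metric.ball p r ×ˢ S) F.U := fun z hz => hVU (hB hz.1)
    have hΛ := fun i j => (F.smooth_Λ i j).continuousOn.comp continuousOn_fst hfst
    have hμ := fun i j => (F.smooth_μ i j).continuousOn.comp continuousOn_fst hfst
    have hent := fun i j => (hΛ i j).add (continuousOn_snd.mul (hμ i j))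
    simp only [det_fin_two]
    exact ((hent 0 0).mul (hent 1 1)).sub ((hent 0 1).mul (hent 1 0))
  have hconn := ((convex_ball p r).prod hS).isPreconnected.image _ hcont
  have hlim : ∀ q, Tendsto (fun l : ℝ => (F.Λ q + l • F.μ q).det) (𝓝[S] 0) (𝓝 (F.lam q)) := by
    intro q
    have hc : Continuous (fun l : ℝ => (F.Λ q + l • F.μ q).det) := by
      simp only [det_fin_two, Matrix.add_apply, Matrix.smul_apply]
      fun_prop
    have := hc.tendsto 0
    simp only [zero_smul, add_zero] at this
    exact this.mono_left nhdsWithin_le_nhds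
  have : (𝓝[S] (0 : ℝ)).NeBot := mem_closure_iff_nhdsWithin_neBot.1 hS0
  have hball : Metric.ball p r ∈ 𝓝 p := Metric.ball_mem_nhds p hr
  have hsign : (∀ q ∈ Metric.ball p r, ∀ l ∈ S, 0 ≤ (F.Λ q + l • F.μ q).det) ∨
      (∀ q ∈ Metric.ball p r, ∀ l ∈ S, (F.Λ q + l • F.μ q).det ≤ 0) := by
    by_contra! ⟨⟨q, hq, l, hl, hneg⟩, q', hq', l', hl', hpos⟩
    obtain ⟨z, hz, hz0⟩ := hconn.Icc_subset
      ⟨(q, l), ⟨hq, hl⟩, rfl⟩ ⟨(q', l'), ⟨hq', hl'⟩, rfl⟩ ⟨hneg.le, hpos.le⟩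
    exact h z.1 (hB hz.1) z.2 hz.2 hz0
  rcases hsign with hs | hs
  · refine IsLocalMin.fderiv_eq_zero (Filter.mem_of_superset hball fun q hq => ?_)
    rw [Set.mem_ofPred_eq, hp.2]
    exact ge_of_tendsto (hlim q) (eventually_mem_nhdsWithin.mono (hs q hq))
  · refine IsLocalMax.fderiv_eq_zero (Filter.mem_of_superset hball fun q hq => ?_)
    rw [Set.mem_ofPred_eq, hp.2]
    exact le_of_tendsto (hlim q) (eventually_mem_nhdsWithin.mono (hs q hq))

/-- at a rank-1 singularity of a wavefront, if `x` is parallelly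
smoothable at `p` then `p` is a degenerated singularity, i.e. `Dλ_Ω(p) = 0`. -/
theorem stmt15 (F : Frontal) (hW : F.IsWavefront)
    (p : Pt) (hp : p ∈ F.sing) (hr : (jac F.x p).rank = 1)
    (hps : F.ParSmoothable p) :
    fderiv ℝ F.lam p = 0 := by
  obtain ⟨ε, hε, V, hV, hpV, hVU, h | h⟩ := hps
  · refine F.fderiv_lam_eq_zero_of_det_ne_zero hp hV hpV hVU (convex_Ioo 0 ε) ?_
      fun q hq l hl => F.det_ne_zero_of_rank_jac_parallel (hVU hq) (h q hq l hl)
    rw [closure_Ioo hε.ne]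
    exact Set.left_mem_Icc.2 hε.le
  · refine F.fderiv_lam_eq_zero_of_det_ne_zero hp hV hpV hVU (convex_Ioo (-ε) 0) ?_
      fun q hq l hl => F.det_ne_zero_of_rank_jac_parallel (hVU hq) (h q hq l hl)
    rw [closure_Ioo (neg_lt_zero.2 hε).ne]
    exact Set.right_mem_Icc.2 (neg_lt_zero.2 hε).le
end
end
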